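/- Let δ > 0, α ∈ ℝ, and let ω : (0, ∞) → ℝ satisfy ω(r) = 0 for r > δ. Define c(ξ) := α ω(‖ξ‖)/‖ξ‖² for ξ ≠ 0 (and c(0) := 0), a(ξ) := c(ξ) ξ, and C(ξ) := c(ξ) ξ⊗ξ, and assume c, a, C are integrable on ℝ³; set p := ∫ c, q := ∫ a, P := ∫ C. Let u : ℝ³ → ℝ³ be bounded and measurable. Then for every x ∈ ℝ³ and each i ∈ {1,2,3}, writing ξ = x′ − x and η = u(x′) − u(x), the nonlinear bond-based internal force density L_i(x) := ∫_{‖ξ‖ ≤ δ} (c(ξ)/2)(2⟨ξ, η⟩ + ‖η‖²)(ξ_i + η_i) dx′ equals Σ_j (C_{ij} ⋆ u_j)(x) − Σ_j P_{ij} u_j(x) − ½ (a_i ⋆ ‖u‖²)(x) + Σ_j (a_i ⋆ u_j)(x) u_j(x) + ½ q_i ‖u(x)‖² − Σ_j (a_j ⋆ (u_j u_i))(x) + Σ_j u_j(x) (a_j ⋆ u_i)(x) + (Σ_j (a_j ⋆ u_j)(x)) u_i(x) + (Σ_j q_j u_j(x)) u_i(x) + ½ (c ⋆ (‖u‖² u_i))(x)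 − Σ_j (c ⋆ (u_i u_j))(x) u_j(x) + ½ (c ⋆ u_i)(x) ‖u(x)‖² − ½ (c ⋆ ‖u‖²)(x) u_i(x) + Σ_j (c ⋆ u_j)(x) u_j(x) u_i(x) − ½ p ‖u(x)‖² u_i(x). (Convolutional decomposition of the rotation-invariant nonlinear bond-based model.) -/

import Mathlib

open MeasureTheory

/-- Scalar convolution `(K ⋆ h)(x) = ∫ K(x − x') h(x') dx'` on `ℝᵈ`. -/
noncomputable def conv {d : ℕ} (K h : EuclideanSpace ℝ (Fin d) → ℝ)
    (x : EuclideanSpace ℝ (Fin d)) : ℝ :=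
  ∫ x', K (x - x') * h x'

/-- `f` is integrable and its integral is `a`. -/
def HasInt {X : Type*} [MeasureSpace X] (f : X → ℝ) (a : ℝ) : Prop :=
  Integrable f ∧ ∫ x, f x = a

namespace HasInt

variable {X : Type*} [MeasureSpace X] {f g : X → ℝ} {a b : ℝ}

lemma add (hf : HasInt f a) (hg : HasInt g b) : HasInt (fun x => f x + g x) (a + b) :=
  ⟨hf.1.add hg.1, by rw [integral_add hf.1 hg.1, hf.2, hg.2]⟩

lemma sub (hf : HasInt f a) (hg : HasInt g b) : HasInt (fun x => f x - g x) (a - b) :=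
  ⟨hf.1.sub hg.1, by rw [integral_sub hf.1 hg.1, hf.2, hg.2]⟩

lemma mul_const (hf : HasInt f a) (r : ℝ) : HasInt (fun x => f x * r) (a * r) :=
  ⟨hf.1.mul_const r, by rw [integral_mul_const, hf.2]⟩

lemma const_mul (r : ℝ) (hf : HasInt f a) : HasInt (fun x => r * f x) (r * a) :=
  ⟨hf.1.const_mul r, by rw [integral_const_mul, hf.2]⟩

lemma sum {ι : Type*} [Fintype ι] {F : ι → X → ℝ} {A : ι → ℝ} (h : ∀ j, HasInt (F j) (A j)) :
    HasInt (fun x => ∑ j, F j x) (∑ j, A j) :=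
  ⟨integrable_finsetSum _ fun j _ => (h j).1, by
    rw [integral_finsetSum _ fun j _ => (h j).1]
    exact Finset.sum_congr rfl fun j _ => (h j).2⟩

lemma conv {d : ℕ} {K h : EuclideanSpace ℝ (Fin d) → ℝ} (hK : Integrable K)
    (hm : Measurable h) {M : ℝ} (hb : ∀ y, |h y| ≤ M) (x : EuclideanSpace ℝ (Fin d)) :
    HasInt (fun x' => K (x - x') * h x') (_root_.conv K h x) :=
  ⟨(hK.comp_sub_left x).mul_bdd (c := M) hm.aestronglyMeasurable (.of_forall hb), rfl⟩

lemma translate {d : ℕ} {K : EuclideanSpace ℝ (Fin d) → ℝ} (hK : Integrable K)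
    (ha : a = ∫ ξ, K ξ) (x : EuclideanSpace ℝ (Fin d)) :
    HasInt (fun x' => K (x' - x)) a :=
  ⟨hK.comp_sub_right x, by rw [ha, integral_sub_right_eq_self K x]⟩

end HasInt

/-- convolutional decomposition of the rotation-invariant nonlinear
bond-based peridynamic model on ℝ³, with kernels `c(ξ) = α ω(‖ξ‖)/‖ξ‖²`,
`a_i(ξ) = c(ξ) ξ_i`, `C_{ij}(ξ) = c(ξ) ξ_i ξ_j` and their integrals `p, q, P`. -/
theorem stmt3 (δ : ℝ) (hδ : 0 < δ) (α : ℝ) (ω : ℝ → ℝ)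
    (hω : ∀ r : ℝ, δ < r → ω r = 0)
    (c : EuclideanSpace ℝ (Fin 3) → ℝ)
    (hc0 : c 0 = 0)
    (hc : ∀ ξ : EuclideanSpace ℝ (Fin 3), ξ ≠ 0 → c ξ = α * ω ‖ξ‖ / ‖ξ‖ ^ 2)
    (hc_int : Integrable c)
    (ha_int : ∀ i, Integrable (fun ξ : EuclideanSpace ℝ (Fin 3) => c ξ * ξ i))
    (hC_int : ∀ i j, Integrable (fun ξ : EuclideanSpace ℝ (Fin 3) => c ξ * ξ i * ξ j))
    (u : EuclideanSpace ℝ (Fin 3) → EuclideanSpace ℝ (Fin 3))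
    (hu_meas : Measurable u) (hu_bdd : ∃ M : ℝ, ∀ y, ‖u y‖ ≤ M)
    (p : ℝ) (hp : p = ∫ ξ, c ξ)
    (q : Fin 3 → ℝ) (hq : ∀ i, q i = ∫ ξ : EuclideanSpace ℝ (Fin 3), c ξ * ξ i)
    (P : Fin 3 → Fin 3 → ℝ)
    (hP : ∀ i j, P i j = ∫ ξ : EuclideanSpace ℝ (Fin 3), c ξ * ξ i * ξ j) :
    ∀ (x : EuclideanSpace ℝ (Fin 3)) (i : Fin 3),
      (∫ x' in Metric.closedBall x δ,
          c (x' - x) / 2 *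
            (2 * (inner ℝ (x' - x) (u x' - u x) : ℝ) + ‖u x' - u x‖ ^ 2) *
            ((x' - x) i + (u x' - u x) i)) =
        (∑ j, conv (fun ξ => c ξ * ξ i * ξ j) (fun y => u y j) x)
        - (∑ j, P i j * u x j)
        - (1 / 2) * conv (fun ξ => c ξ * ξ i) (fun y => ‖u y‖ ^ 2) x
        + (∑ j, conv (fun ξ => c ξ * ξ i) (fun y => u y j) x * u x j)
        + (1 / 2) * q i * ‖u x‖ ^ 2
        - (∑ j, conv (fun ξ => c ξ * ξ j) (fun y => u y j * u y i) x)
        + (∑ j, u x j * conv (fun ξ => c ξ * ξ j) (fun y => u y i) x)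
        + (∑ j, conv (fun ξ => c ξ * ξ j) (fun y => u y j) x) * u x i
        + (∑ j, q j * u x j) * u x i
        + (1 / 2) * conv c (fun y => ‖u y‖ ^ 2 * u y i) x
        - (∑ j, conv c (fun y => u y i * u y j) x * u x j)
        + (1 / 2) * conv c (fun y => u y i) x * ‖u x‖ ^ 2
        - (1 / 2) * conv c (fun y => ‖u y‖ ^ 2) x * u x i
        + (∑ j, conv c (fun y => u y j) x * u x j * u x i)
        - (1 / 2) * p * ‖u x‖ ^ 2 * u x i := by
  intro x i
  obtain ⟨M, hM⟩ := hu_bdd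
  have hM0 : 0 ≤ M := (norm_nonneg _).trans (hM 0)
  have c_even : ∀ ξ, c (-ξ) = c ξ := by
    intro ξ
    by_cases h : ξ = 0
    · simp [h]
    · rw [hc _ (neg_ne_zero.mpr h), hc _ h, norm_neg]
  have c_supp : ∀ ξ, δ < ‖ξ‖ → c ξ = 0 := by
    intro ξ h
    rw [hc ξ (norm_pos_iff.mp (hδ.trans h)), hω _ h]
    simp
  have m1 : ∀ j, Measurable fun y => u y j := fun j => by fun_prop
  have m2 : Measurable fun y => ‖u y‖ ^ 2 := by fun_prop
  have b1 : ∀ j y, |u y j| ≤ M := fun j y =>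
    (PiLp.norm_apply_le (u y) j).trans (hM y)
  have b2 : ∀ y, |‖u y‖ ^ 2| ≤ M ^ 2 := fun y => by
    rw [abs_of_nonneg (sq_nonneg _)]
    exact pow_le_pow_left₀ (norm_nonneg _) (hM y) 2
  have b11 : ∀ j k y, |u y j * u y k| ≤ M * M := fun j k y => by
    rw [abs_mul]
    exact mul_le_mul (b1 j y) (b1 k y) (abs_nonneg _) hM0
  have b21 : ∀ j y, |‖u y‖ ^ 2 * u y j| ≤ M ^ 2 * M := fun j y => by
    rw [abs_mul]
    exact mul_le_mul (b2 y) (b1 j y) (abs_nonneg _) (sq_nonneg M)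
  rw [setIntegral_eq_integral_of_forall_compl_eq_zero]
  swap
  · intro x' hx'
    rw [Metric.mem_closedBall, dist_eq_norm, not_le] at hx'
    rw [c_supp _ hx']
    simp
  have key := ((((((((((((((HasInt.sum fun j => HasInt.conv (hC_int i j) (m1 j) (b1 j) x).sub
    (HasInt.sum fun j => (HasInt.translate (hC_int i j) (hP i j) x).mul_const (u x j))).sub
    ((HasInt.conv (ha_int i) m2 b2 x).const_mul (1 / 2))).add
    (HasInt.sum fun j => (HasInt.conv (ha_int i) (m1 j) (b1 j) x).mul_const (u x j))).add
    (((HasInt.translate (ha_int i) (hq i) x).const_mul (1 / 2)).mul_const (‖u x‖ ^ 2))).sub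
    (HasInt.sum fun j => HasInt.conv (ha_int j) ((m1 j).mul (m1 i)) (b11 j i) x)).add
    (HasInt.sum fun j => (HasInt.conv (ha_int j) (m1 i) (b1 i) x).const_mul (u x j))).add
    ((HasInt.sum fun j => HasInt.conv (ha_int j) (m1 j) (b1 j) x).mul_const (u x i))).add
    ((HasInt.sum fun j =>
      (HasInt.translate (ha_int j) (hq j) x).mul_const (u x j)).mul_const (u x i))).add
    ((HasInt.conv hc_int (m2.mul (m1 i)) (b21 i) x).const_mul (1 / 2))).sub
    (HasInt.sum fun j =>
      (HasInt.conv hc_int ((m1 i).mul (m1 j)) (b11 i j) x).mul_const (u x j))).add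
    (((HasInt.conv hc_int (m1 i) (b1 i) x).const_mul (1 / 2)).mul_const (‖u x‖ ^ 2))).sub
    (((HasInt.conv hc_int m2 b2 x).const_mul (1 / 2)).mul_const (u x i))).add
    (HasInt.sum fun j =>
      ((HasInt.conv hc_int (m1 j) (b1 j) x).mul_const (u x j)).mul_const (u x i))).sub
    ((((HasInt.translate hc_int hp x).const_mul (1 / 2)).mul_const (‖u x‖ ^ 2)).mul_const (u x i))
  refine Eq.trans (integral_congr_ae (.of_forall fun x' => ?_)) key.2
  have e : c (x - x') = c (x' - x) := by rw [← c_even, neg_sub]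
  simp only [e, EuclideanSpace.real_norm_sq_eq, PiLp.inner_apply, Fin.sum_univ_three,
    PiLp.sub_apply, RCLike.inner_apply, conj_trivial, Pi.mul_apply]
  ring
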